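/- Let $P_n(x)$ be the sequence of real polynomials defined by $P_0(x)=1$, $P_1(x)=x^2+4x+1$, and $P_n(x)=(x^2+4x+1)P_{n-1}(x)-x^2P_{n-2}(x)$ for $n\ge 2$. Then for every $n\ge 0$, as an identity of polynomials, $P_n(x)=\sum_{i=0}^{n}\binom{2n+1-i}{i}x^i(x+1)^{2n-2i}$. -/

import Mathlib

open Polynomial

/-- The sextet polynomials of the pyrene chains. -/
noncomputable def pyreneP : ℕ → Polynomial ℝ
  | 0 => 1
  | 1 => X ^ 2 + 4 * X + 1
  | (n + 2) => (X ^ 2 + 4 * X + 1) * pyreneP (n + 1) - X ^ 2 * pyreneP n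

section FibonacciSums

variable {R : Type*} [CommRing R]

/-- The homogenized Fibonacci polynomial `∑ i ≤ n, (2n + 1 - i choose i) x ^ i y ^ (n - i)`
of odd index. -/
def oddFibSum (x y : R) (n : ℕ) : R :=
  ∑ i ∈ Finset.range (n + 1), ((2 * n + 1 - i).choose i : R) * x ^ i * y ^ (n - i)

/-- The homogenized Fibonacci polynomial `∑ i ≤ n, (2n - i choose i) x ^ i y ^ (n - i)`
of even index. -/
def evenFibSum (x y : R) (n : ℕ) : R :=
  ∑ i ∈ Finset.range (n + 1), ((2 * n - i).choose i : R) * x ^ i * y ^ (n - i)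

theorem oddFibSum_succ (x y : R) (n : ℕ) :
    oddFibSum x y (n + 1) = evenFibSum x y (n + 1) + x * oddFibSum x y n := by
  unfold oddFibSum evenFibSum
  rw [Finset.sum_range_succ', Finset.sum_range_succ' _ (n + 1), Finset.mul_sum,
    add_right_comm, ← Finset.sum_add_distrib]
  congr 1
  refine Finset.sum_congr rfl fun i hi => ?_
  have hi : i < n + 1 := Finset.mem_range.mp hi
  rw [show 2 * (n + 1) + 1 - (i + 1) = (2 * n + 1 - i) + 1 by lia,
    show 2 * (n + 1) - (i + 1) = 2 * n + 1 - i by lia,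
    Nat.add_sub_add_right, Nat.choose_succ_succ']
  push_cast
  ring

theorem mul_oddFibSum (x y : R) (n : ℕ) :
    y * oddFibSum x y n = ∑ i ∈ Finset.range (n + 2),
      ((2 * n + 1 - i).choose i : R) * x ^ i * y ^ (n + 1 - i) := by
  rw [Finset.sum_range_succ, Nat.choose_eq_zero_of_lt (by lia), oddFibSum, Finset.mul_sum]
  simp only [Nat.cast_zero, zero_mul, add_zero]
  refine Finset.sum_congr rfl fun i hi => ?_
  have hi : i < n + 1 := Finset.mem_range.mp hi
  rw [show n + 1 - i = (n - i) + 1 by lia]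
  ring

theorem evenFibSum_succ (x y : R) (n : ℕ) :
    evenFibSum x y (n + 1) = y * oddFibSum x y n + x * evenFibSum x y n := by
  rw [mul_oddFibSum]
  unfold evenFibSum
  rw [Finset.sum_range_succ', Finset.sum_range_succ' _ (n + 1), Finset.mul_sum,
    add_right_comm, ← Finset.sum_add_distrib]
  congr 1
  refine Finset.sum_congr rfl fun i hi => ?_
  have hi : i < n + 1 := Finset.mem_range.mp hi
  rw [show 2 * (n + 1) - (i + 1) = (2 * n - i) + 1 by lia,
    show 2 * n + 1 - (i + 1) = 2 * n - i by lia,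
    Nat.add_sub_add_right, Nat.choose_succ_succ']
  push_cast
  ring

theorem oddFibSum_add_two (x y : R) (n : ℕ) :
    oddFibSum x y (n + 2) = (y + 2 * x) * oddFibSum x y (n + 1) - x ^ 2 * oddFibSum x y n := by
  linear_combination oddFibSum_succ x y (n + 1) + evenFibSum_succ x y (n + 1)
    - x * oddFibSum_succ x y n

end FibonacciSums

theorem pyreneP_eq_oddFibSum (n : ℕ) : pyreneP n = oddFibSum X ((X + 1) ^ 2) n := by
  induction n using Nat.twoStepInduction with
  | zero => simp [pyreneP, oddFibSum]
  | one =>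
    simp [pyreneP, oddFibSum, Finset.sum_range_succ]
    ring
  | more n ih₀ ih₁ =>
    rw [pyreneP, oddFibSum_add_two, ih₀, ih₁]
    ring

theorem pyreneP_explicit (n : ℕ) :
    pyreneP n = ∑ i ∈ Finset.range (n + 1),
      (C (((2 * n + 1 - i).choose i : ℝ)) * X ^ i * (X + 1) ^ (2 * n - 2 * i)) := by
  rw [pyreneP_eq_oddFibSum, oddFibSum]
  refine Finset.sum_congr rfl fun i _ => ?_
  rw [← pow_mul, Nat.mul_sub, map_natCast]
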